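/- For all t ∈ ℝ and ξ ∈ ℝⁿ, the identity A(t,ξ) · C(t,ξ) · Q(t,ξ) · cos(B(t,ξ) − D(t,ξ)) = 1 holds. -/

import Mathlib

/-- The primitive of a continuous function is differentiable with the expected derivative. -/
lemma hasDerivAt_of_eq_integral {V : Type*} [NormedAddCommGroup V] [NormedSpace ℝ V]
    [CompleteSpace V] {F f : ℝ → V} (hf : Continuous f)
    (hF : ∀ t, F t = ∫ s in (0:ℝ)..t, f s) (t : ℝ) : HasDerivAt F (f t) t := by
  rw [funext hF]
  exact (hf.integral_hasStrictDerivAt 0 t).hasDerivAt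

/-- Conservation of the normalized Wronskian in Prüfer variables. -/
lemma prufer_wronskian_eq_one {Q B D : ℝ → ℝ} (hQ : ContDiff ℝ 1 Q) (hpos : ∀ t, 0 < Q t)
    (hBc : Continuous B) (hDc : Continuous D)
    (hB : ∀ t, B t = ∫ s in (0:ℝ)..t, (Q s - deriv Q s / Q s * Real.sin (B s) * Real.cos (B s)))
    (hD : ∀ t, D t = ∫ s in (0:ℝ)..t, (Q s + deriv Q s / Q s * Real.sin (D s) * Real.cos (D s)))
    (t : ℝ) :
    Real.exp (-∫ s in (0:ℝ)..t, deriv Q s / Q s * Real.sin (B s) ^ 2) *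
      ((Q 0)⁻¹ * Real.exp (-∫ s in (0:ℝ)..t, deriv Q s / Q s * Real.cos (D s) ^ 2)) *
      Q t * Real.cos (B t - D t) = 1 := by
  have hQc : Continuous Q := hQ.continuous
  have hp : Continuous fun s => deriv Q s / Q s :=
    (hQ.continuous_deriv le_rfl).div hQc fun s => (hpos s).ne'
  have dB := hasDerivAt_of_eq_integral (by fun_prop) hB
  have dD := hasDerivAt_of_eq_integral (by fun_prop) hD
  have dα := hasDerivAt_of_eq_integral
    (f := fun s => deriv Q s / Q s * Real.sin (B s) ^ 2) (by fun_prop) fun _ => rfl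
  have dγ := hasDerivAt_of_eq_integral
    (f := fun s => deriv Q s / Q s * Real.cos (D s) ^ 2) (by fun_prop) fun _ => rfl
  have dQ : ∀ s, HasDerivAt Q (deriv Q s) s := fun s =>
    (hQ.differentiable one_ne_zero s).hasDerivAt
  have key := fun s => (((dα s).neg.exp.mul ((dγ s).neg.exp.const_mul (Q 0)⁻¹)).mul (dQ s)).mul
    ((dB s).sub (dD s)).cos
  have zero := fun s => (key s).congr_deriv (g' := 0) (by
    have hne := (hpos s).ne'
    have hdQ : deriv Q s = deriv Q s / Q s * Q s := by field_simp
    simp only [Pi.mul_apply, Pi.neg_apply, Pi.sub_apply, Real.cos_sub, Real.sin_sub]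
    generalize deriv Q s / Q s = p at hdQ ⊢
    rw [hdQ]
    have h₁ := Real.sin_sq_add_cos_sq (B s)
    have h₂ := Real.sin_sq_add_cos_sq (D s)
    generalize Real.exp (-∫ s in (0:ℝ)..s, deriv Q s / Q s * Real.sin (B s) ^ 2) = α
    generalize Real.exp (-∫ s in (0:ℝ)..s, deriv Q s / Q s * Real.cos (D s) ^ 2) = γ
    linear_combination (-(α * ((Q 0)⁻¹ * γ) * Q s * p)) *
      (Real.sin (B s) * Real.sin (D s) * h₁ + Real.cos (B s) * Real.cos (D s) * h₂))
  have hconst := is_const_of_deriv_eq_zero (fun s => (zero s).differentiableAt)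
    (fun s => (zero s).deriv) t 0
  have hB0 : B 0 = 0 := by rw [hB, intervalIntegral.integral_same]
  have hD0 : D 0 = 0 := by rw [hD, intervalIntegral.integral_same]
  simpa [hB0, hD0, (hpos 0).ne'] using hconst


open MeasureTheory in
theorem stmt_11
    (n : ℕ) (hn : 1 ≤ n) (c m q : ℝ) (hc : 0 < c) (hm : 0 < m) (hq : q ≠ 0)
    (E : ℝ → EuclideanSpace ℝ (Fin n)) (E00 E01 : ℝ)
    (hE : ContDiff ℝ 1 E)
    (hE00 : ∀ t : ℝ, ∑ j, |E t j| ≤ E00)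
    (hE01 : ∀ t : ℝ, ∑ j, |deriv E t j| ≤ E01)
    (b : ℝ → EuclideanSpace ℝ (Fin n))
    (hb : ∀ t : ℝ, b t = ∫ s in (0:ℝ)..t, q • E s)
    (L Q : ℝ → EuclideanSpace ℝ (Fin n) → ℝ)
    (hL : ∀ (t : ℝ) (ξ : EuclideanSpace ℝ (Fin n)),
      L t ξ = c ^ 2 * ‖ξ + b t‖ ^ 2 + (m * c ^ 2) ^ 2)
    (hQ : ∀ (t : ℝ) (ξ : EuclideanSpace ℝ (Fin n)), Q t ξ = Real.sqrt (L t ξ))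
    (B : ℝ → EuclideanSpace ℝ (Fin n) → ℝ)
    (hBC2 : ∀ ξ : EuclideanSpace ℝ (Fin n), ContDiff ℝ 2 (fun t => B t ξ))
    (hB : ∀ (t : ℝ) (ξ : EuclideanSpace ℝ (Fin n)), B t ξ =
      ∫ s in (0:ℝ)..t,
        (Q s ξ - deriv (fun τ => Q τ ξ) s / Q s ξ * Real.sin (B s ξ) * Real.cos (B s ξ)))
    (D : ℝ → EuclideanSpace ℝ (Fin n) → ℝ)
    (hDC2 : ∀ ξ : EuclideanSpace ℝ (Fin n), ContDiff ℝ 2 (fun t => D t ξ))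
    (hD : ∀ (t : ℝ) (ξ : EuclideanSpace ℝ (Fin n)), D t ξ =
      ∫ s in (0:ℝ)..t,
        (Q s ξ + deriv (fun τ => Q τ ξ) s / Q s ξ * Real.sin (D s ξ) * Real.cos (D s ξ)))
    (A : ℝ → EuclideanSpace ℝ (Fin n) → ℝ)
    (hA : ∀ (t : ℝ) (ξ : EuclideanSpace ℝ (Fin n)), A t ξ =
      Real.exp (-∫ s in (0:ℝ)..t, deriv (fun τ => Q τ ξ) s / Q s ξ * Real.sin (B s ξ) ^ 2))
    (Cc : ℝ → EuclideanSpace ℝ (Fin n) → ℝ)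
    (hCc : ∀ (t : ℝ) (ξ : EuclideanSpace ℝ (Fin n)), Cc t ξ =
      (Q 0 ξ)⁻¹ * Real.exp (-∫ s in (0:ℝ)..t, deriv (fun τ => Q τ ξ) s / Q s ξ * Real.cos (D s ξ) ^ 2))
    :
    ∀ (t : ℝ) (ξ : EuclideanSpace ℝ (Fin n)),
      A t ξ * Cc t ξ * Q t ξ * Real.cos (B t ξ - D t ξ) = 1 := by
  intro t ξ
  have db := hasDerivAt_of_eq_integral (hE.continuous.const_smul q) hb
  have hb1 : ContDiff ℝ 1 b := by
    refine contDiff_one_iff_deriv.2 ⟨fun s => (db s).differentiableAt, ?_⟩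
    rw [funext fun s => (db s).deriv]
    exact hE.continuous.const_smul q
  have hLpos : ∀ s, 0 < c ^ 2 * ‖ξ + b s‖ ^ 2 + (m * c ^ 2) ^ 2 := fun s => by positivity
  have hQξ : (fun s => Q s ξ) = fun s => √(c ^ 2 * ‖ξ + b s‖ ^ 2 + (m * c ^ 2) ^ 2) := by
    funext s
    rw [hQ, hL]
  have hQ1 : ContDiff ℝ 1 fun s => Q s ξ := by
    rw [hQξ]
    exact ((contDiff_const.mul ((contDiff_const.add hb1).norm_sq ℝ)).add contDiff_const).sqrt
      fun s => (hLpos s).ne'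
  have hQpos : ∀ s, 0 < Q s ξ := fun s => by
    rw [hQ, hL]
    exact Real.sqrt_pos.2 (hLpos s)
  rw [hA, hCc]
  exact prufer_wronskian_eq_one hQ1 hQpos (hBC2 ξ).continuous (hDC2 ξ).continuous
    (fun s => hB s ξ) (fun s => hD s ξ) t
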